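/- arXiv:2009.03436 — 6 statements merged into one kernel-verified Lean document; each statement's English description precedes it below -/
import Mathlib

section
/- Let P be an n×n real row-stochastic matrix, i a fixed index, and v ∈ ℝⁿ with Σ_k v_k = 0. Assume Iₙ₋₁ − Z_i is invertible and that d := 1 + 𝟏'(Iₙ₋₁ − Z_i)⁻¹ α_i ≠ 0. If the row vector x ∈ ℝⁿ satisfies x(Iₙ − P) = v and Σ_k x_k = 0, then x_i = − 𝟏'(Iₙ₋₁ − Z_i)⁻¹ v₋ᵢ / d, where v₋ᵢ is viewed as a column vector in ℝⁿ⁻¹. -/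
open Matrix BigOperators

/-- `Zmat P i` is the transpose of `P` with its `i`-th row and `i`-th column removed:
`(Zmat P i) s t = P t s` for indices `s, t ≠ i`. -/
def Zmat {n : ℕ} (P : Matrix (Fin (n + 1)) (Fin (n + 1)) ℝ) (i : Fin (n + 1)) :
    Matrix (Fin n) (Fin n) ℝ :=
  Matrix.of fun s t => P (i.succAbove t) (i.succAbove s)

/-- `alphaVec P i` is the `i`-th row of `P` with its `i`-th entry dropped. -/
def alphaVec {n : ℕ} (P : Matrix (Fin (n + 1)) (Fin (n + 1)) ℝ) (i : Fin (n + 1)) :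
    Fin n → ℝ :=
  fun s => P i (i.succAbove s)

/-- `dropIdx i w` is the vector `w` with its `i`-th entry removed. -/
def dropIdx {n : ℕ} (i : Fin (n + 1)) (w : Fin (n + 1) → ℝ) : Fin n → ℝ :=
  fun s => w (i.succAbove s)

/-- The all-ones column vector in `ℝⁿ`. -/
def ones (n : ℕ) : Fin n → ℝ := fun _ => 1

/-- Dropping the `i`-th coordinate of `x (1 - P)` leaves `(1 - Z_i) x₋ᵢ - x_i α_i`. -/
theorem one_sub_Zmat_mulVec_dropIdx {n : ℕ} (P : Matrix (Fin (n + 1)) (Fin (n + 1)) ℝ)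
    (i : Fin (n + 1)) (x : Fin (n + 1) → ℝ) :
    (1 - Zmat P i) *ᵥ dropIdx i x = dropIdx i (x ᵥ* (1 - P)) + x i • alphaVec P i := by
  ext s
  rw [sub_mulVec, one_mulVec, vecMul_sub, vecMul_one]
  simp only [Pi.sub_apply, Pi.add_apply, Pi.smul_apply, smul_eq_mul, dropIdx, alphaVec, mulVec,
    vecMul, dotProduct, Zmat, of_apply, Fin.sum_univ_succAbove _ i, mul_comm (P _ _)]
  ring

theorem ones_dotProduct_dropIdx {n : ℕ} (i : Fin (n + 1)) (x : Fin (n + 1) → ℝ) :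
    ones n ⬝ᵥ dropIdx i x = ∑ k, x k - x i := by
  simp [ones, dropIdx, dotProduct, Fin.sum_univ_succAbove _ i]

/-- If `x (Iₙ − P) = v` with `Σ x = 0` and `Σ v = 0`, then
`x_i = − 𝟏ᵀ (Iₙ₋₁ − Z_i)⁻¹ v₋ᵢ / (1 + 𝟏ᵀ (Iₙ₋₁ − Z_i)⁻¹ α_i)`. -/
theorem xi_formula (n : ℕ) (P : Matrix (Fin (n + 1)) (Fin (n + 1)) ℝ)
    (hpos : ∀ s t, 0 ≤ P s t) (hrow : ∀ s, ∑ t, P s t = 1)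
    (i : Fin (n + 1)) (v : Fin (n + 1) → ℝ) (hv : ∑ k, v k = 0)
    (hinv : IsUnit (1 - Zmat P i).det)
    (hd : 1 + ones n ⬝ᵥ ((1 - Zmat P i)⁻¹ *ᵥ alphaVec P i) ≠ 0)
    (x : Fin (n + 1) → ℝ)
    (hsol : x ᵥ* (1 - P) = v) (hx : ∑ k, x k = 0) :
    x i = -(ones n ⬝ᵥ ((1 - Zmat P i)⁻¹ *ᵥ dropIdx i v)) /
      (1 + ones n ⬝ᵥ ((1 - Zmat P i)⁻¹ *ᵥ alphaVec P i)) := by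
  have hdrop : dropIdx i x =
      (1 - Zmat P i)⁻¹ *ᵥ dropIdx i v + x i • ((1 - Zmat P i)⁻¹ *ᵥ alphaVec P i) := by
    rw [← mulVec_smul, ← mulVec_add, ← hsol, ← one_sub_Zmat_mulVec_dropIdx, mulVec_mulVec,
      nonsing_inv_mul _ hinv, one_mulVec]
  have hsum := ones_dotProduct_dropIdx i x
  rw [hx, hdrop, dotProduct_add, dotProduct_smul, smul_eq_mul] at hsum
  rw [eq_div_iff hd]
  linarith
end

section
/- Let P be an n×n real row-stochastic matrix, i a fixed index, and v ∈ ℝⁿ with Σ_k v_k = 0. Assume Iₙ₋₁ − Z_i is invertible and d := 1 + 𝟏'(Iₙ₋₁ − Z_i)⁻¹ α_i ≠ 0. If the row vector x ∈ ℝⁿ satisfies x(Iₙ − P) = v and Σ_k x_k = 0, then the vector x₋ᵢ of its coordinates other than the i-th satisfies x₋ᵢ = (Iₙ₋₁ − Z_i)⁻¹ [ v₋ᵢ − (𝟏'(Iₙ₋₁ − Z_i)⁻¹ v₋ᵢ / d) · α_i ], where v₋ᵢ and x₋ᵢ are viewed as column vectors in ℝⁿ⁻¹. -/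
open Matrix BigOperators

/-- If `x (Iₙ − P) = v` with `Σ x = 0` and `Σ v = 0`, then
`x₋ᵢ = (Iₙ₋₁ − Z_i)⁻¹ [ v₋ᵢ − (𝟏ᵀ (Iₙ₋₁ − Z_i)⁻¹ v₋ᵢ / d) α_i ]`
where `d = 1 + 𝟏ᵀ (Iₙ₋₁ − Z_i)⁻¹ α_i`. -/
theorem xminusi_formula (n : ℕ) (P : Matrix (Fin (n + 1)) (Fin (n + 1)) ℝ)
    (hpos : ∀ s t, 0 ≤ P s t) (hrow : ∀ s, ∑ t, P s t = 1)
    (i : Fin (n + 1)) (v : Fin (n + 1) → ℝ) (hv : ∑ k, v k = 0)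
    (hinv : IsUnit (1 - Zmat P i).det)
    (hd : 1 + ones n ⬝ᵥ ((1 - Zmat P i)⁻¹ *ᵥ alphaVec P i) ≠ 0)
    (x : Fin (n + 1) → ℝ)
    (hsol : x ᵥ* (1 - P) = v) (hx : ∑ k, x k = 0) :
    dropIdx i x =
      (1 - Zmat P i)⁻¹ *ᵥ
        (dropIdx i v -
          ((ones n ⬝ᵥ ((1 - Zmat P i)⁻¹ *ᵥ dropIdx i v)) /
            (1 + ones n ⬝ᵥ ((1 - Zmat P i)⁻¹ *ᵥ alphaVec P i))) • alphaVec P i) := by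
  have hy : dropIdx i x =
      (1 - Zmat P i)⁻¹ *ᵥ dropIdx i v + x i • ((1 - Zmat P i)⁻¹ *ᵥ alphaVec P i) := by
    rw [← mulVec_smul, ← mulVec_add, ← hsol, ← one_sub_Zmat_mulVec_dropIdx, mulVec_mulVec,
      nonsing_inv_mul _ hinv, one_mulVec]
  have hs := ones_dotProduct_dropIdx i x
  rw [hx, hy, dotProduct_add, dotProduct_smul, smul_eq_mul] at hs
  have hxi : x i = -((ones n ⬝ᵥ ((1 - Zmat P i)⁻¹ *ᵥ dropIdx i v)) /
      (1 + ones n ⬝ᵥ ((1 - Zmat P i)⁻¹ *ᵥ alphaVec P i))) := by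
    rw [← neg_div, eq_div_iff hd]
    linarith
  rw [hy, hxi, mulVec_sub, mulVec_smul, neg_smul, ← sub_eq_add_neg]
end

section
/- Let P be an n×n real row-stochastic matrix, i a fixed index, and v ∈ ℝⁿ with Σ_k v_k = 0. If Iₙ₋₁ − Z_i is invertible and 1 + 𝟏'(Iₙ₋₁ − Z_i)⁻¹ α_i ≠ 0, then there exists a unique row vector x ∈ ℝⁿ satisfying both x(Iₙ − P) = v and Σ_k x_k = 0. -/
open Matrix BigOperators

theorem sum_vecMul_one_sub {ι : Type*} [Fintype ι] [DecidableEq ι] {P : Matrix ι ι ℝ}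
    (hrow : ∀ s, ∑ t, P s t = 1) (x : ι → ℝ) : ∑ k, (x ᵥ* (1 - P)) k = 0 := by
  have h : (1 - P) *ᵥ (1 : ι → ℝ) = 0 := by
    ext s
    simp [mulVec, dotProduct, hrow, Matrix.one_apply]
  rw [← dotProduct_one, ← dotProduct_mulVec, h, dotProduct_zero]

theorem vecMul_one_sub_succAbove {n : ℕ} (P : Matrix (Fin (n + 1)) (Fin (n + 1)) ℝ)
    (i : Fin (n + 1)) (x : Fin (n + 1) → ℝ) (s : Fin n) :
    (x ᵥ* (1 - P)) (i.succAbove s) =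
      ((1 - Zmat P i) *ᵥ dropIdx i x) s - x i * alphaVec P i s := by
  have h : (x ᵥ* P) (i.succAbove s) =
      x i * alphaVec P i s + (Zmat P i *ᵥ dropIdx i x) s := by
    simp only [vecMul, mulVec, dotProduct, Fin.sum_univ_succAbove _ i, Zmat, of_apply,
      alphaVec, dropIdx, mul_comm]
  simp only [vecMul_sub, vecMul_one, sub_mulVec, one_mulVec, Pi.sub_apply, h, dropIdx]
  ring

/-- Zero-sum right-hand sides make the `i`-th equation of `x (I - P) = v` redundant. -/
theorem vecMul_one_sub_eq_iff {n : ℕ} {P : Matrix (Fin (n + 1)) (Fin (n + 1)) ℝ}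
    (hrow : ∀ s, ∑ t, P s t = 1) (i : Fin (n + 1)) {v : Fin (n + 1) → ℝ}
    (hv : ∑ k, v k = 0) (x : Fin (n + 1) → ℝ) :
    x ᵥ* (1 - P) = v ↔
      (1 - Zmat P i) *ᵥ dropIdx i x = dropIdx i v + x i • alphaVec P i := by
  have hdrop : ∀ s, (x ᵥ* (1 - P)) (i.succAbove s) = v (i.succAbove s) ↔
      ((1 - Zmat P i) *ᵥ dropIdx i x) s = (dropIdx i v + x i • alphaVec P i) s := by
    intro s
    rw [vecMul_one_sub_succAbove, sub_eq_iff_eq_add]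
    rfl
  constructor
  · intro h
    ext s
    exact (hdrop s).1 (congrFun h _)
  · intro h
    have hs : ∀ s, (x ᵥ* (1 - P)) (i.succAbove s) = v (i.succAbove s) :=
      fun s => (hdrop s).2 (congrFun h s)
    have hsum := sum_vecMul_one_sub hrow x
    rw [Fin.sum_univ_succAbove _ i, Finset.sum_congr rfl fun s _ => hs s] at hsum
    rw [Fin.sum_univ_succAbove _ i] at hv
    ext k
    rcases Fin.eq_self_or_eq_succAbove i k with rfl | ⟨s, rfl⟩
    · linarith
    · exact hs s

/-- If `Iₙ₋₁ − Z_i` is invertible and `1 + 𝟏ᵀ (Iₙ₋₁ − Z_i)⁻¹ α_i ≠ 0`, then for any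
zero-sum `v` there is a unique row vector `x` with `x (Iₙ − P) = v` and `Σ x = 0`. -/
theorem exists_unique_solution (n : ℕ) (P : Matrix (Fin (n + 1)) (Fin (n + 1)) ℝ)
    (hpos : ∀ s t, 0 ≤ P s t) (hrow : ∀ s, ∑ t, P s t = 1)
    (i : Fin (n + 1)) (v : Fin (n + 1) → ℝ) (hv : ∑ k, v k = 0)
    (hinv : IsUnit (1 - Zmat P i).det)
    (hd : 1 + ones n ⬝ᵥ ((1 - Zmat P i)⁻¹ *ᵥ alphaVec P i) ≠ 0) :
    ∃! x : Fin (n + 1) → ℝ, x ᵥ* (1 - P) = v ∧ ∑ k, x k = 0 := by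
  have hsol : ∀ y w : Fin n → ℝ, (1 - Zmat P i) *ᵥ y = w ↔ y = (1 - Zmat P i)⁻¹ *ᵥ w := by
    intro y w
    constructor <;> rintro rfl
    · rw [mulVec_mulVec, nonsing_inv_mul _ hinv, one_mulVec]
    · rw [mulVec_mulVec, mul_nonsing_inv _ hinv, one_mulVec]
  have hsum : ∀ x : Fin (n + 1) → ℝ, ∑ k, x k = x i + ones n ⬝ᵥ dropIdx i x := by
    intro x
    simp [Fin.sum_univ_succAbove _ i, dotProduct, ones, dropIdx]
  simp only [vecMul_one_sub_eq_iff hrow i hv, hsol, hsum, mulVec_add, mulVec_smul]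
  generalize (1 - Zmat P i)⁻¹ *ᵥ dropIdx i v = u
  generalize (1 - Zmat P i)⁻¹ *ᵥ alphaVec P i = a at hd ⊢
  refine ⟨i.insertNth (-(ones n ⬝ᵥ u) / (1 + ones n ⬝ᵥ a))
    (u + (-(ones n ⬝ᵥ u) / (1 + ones n ⬝ᵥ a)) • a), ⟨?_, ?_⟩, ?_⟩
  · ext s
    simp [dropIdx]
  · have hins : ∀ (c : ℝ) (y : Fin n → ℝ),
        dropIdx i (i.insertNth c y : Fin (n + 1) → ℝ) = y := by
      intro c y
      ext s
      simp [dropIdx]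
    rw [hins, Fin.insertNth_apply_same, dotProduct_add, dotProduct_smul, smul_eq_mul]
    field_simp
    ring
  · rintro x ⟨hx, hx0⟩
    rw [hx, dotProduct_add, dotProduct_smul, smul_eq_mul] at hx0
    have hc : x i = -(ones n ⬝ᵥ u) / (1 + ones n ⬝ᵥ a) := by
      rw [eq_div_iff hd]
      linarith
    rw [← hc, ← hx]
    ext k
    rcases Fin.eq_self_or_eq_succAbove i k with rfl | ⟨s, rfl⟩
    · simp
    · simp [dropIdx]
end

section
/- (Theorem 1, Eq. (2)). Let P be an n×n real row-stochastic matrix and let π ∈ ℝⁿ be an authority distribution for P, i.e. πP = π, Σ_k π_k = 1, and π_k ≥ 0 for all k. Fix distinct indices i ≠ j and a real constant λ_{ji}, and let v ∈ ℝⁿ be the row vector whose i-th entry is −λ_{ji}π_i + π_j, whose j-th entry is λ_{ji}π_i − π_j, and whose other entries are 0. Assume Iₙ₋₁ − Z_i is invertible and d := 1 + 𝟏'(Iₙ₋₁ − Z_i)⁻¹ α_i ≠ 0. If the row vector x ∈ ℝⁿ satisfies x(Iₙ − P) = v and Σ_k x_k = 0 (so that x is the derivative dπ/dP_{ji} under the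 trade-war perturbation), then x_i = − (λ_{ji}π_i − π_j) · 𝟏'(Iₙ₋₁ − Z_i)⁻¹ γ_{ji} / d. -/
open Matrix BigOperators

/-- Deleting the `i`-th coordinate of `x ᵥ* (1 - P)` leaves a linear system in `dropIdx i x`. -/
theorem dropIdx_vecMul_one_sub {n : ℕ} (P : Matrix (Fin (n + 1)) (Fin (n + 1)) ℝ)
    (i : Fin (n + 1)) (x : Fin (n + 1) → ℝ) :
    dropIdx i (x ᵥ* (1 - P)) = (1 - Zmat P i) *ᵥ dropIdx i x - x i • alphaVec P i := by
  rw [Matrix.vecMul_sub, Matrix.vecMul_one, Matrix.sub_mulVec, Matrix.one_mulVec]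
  ext s
  simp only [dropIdx, Pi.sub_apply, Pi.smul_apply, smul_eq_mul, alphaVec, Matrix.vecMul,
    Matrix.mulVec, dotProduct, Zmat, Matrix.of_apply]
  rw [Fin.sum_univ_succAbove _ i]
  simp only [mul_comm (P _ _)]
  ring

/-- Theorem 1, Eq. (2): in the trade war of country `i` against `j` with reaction
coefficient `λ_{ji}`, the derivative `x = dπ/dP_{ji}` satisfies
`x_i = −(λ_{ji} π_i − π_j) 𝟏ᵀ (Iₙ₋₁ − Z_i)⁻¹ γ_{ji} / (1 + 𝟏ᵀ (Iₙ₋₁ − Z_i)⁻¹ α_i)`. -/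
theorem trade_war_derivative_i (n : ℕ) (P : Matrix (Fin (n + 1)) (Fin (n + 1)) ℝ)
    (hpos : ∀ s t, 0 ≤ P s t) (hrow : ∀ s, ∑ t, P s t = 1)
    (piv : Fin (n + 1) → ℝ)
    (hpi : piv ᵥ* P = piv) (hpisum : ∑ k, piv k = 1) (hpipos : ∀ k, 0 ≤ piv k)
    (i j : Fin (n + 1)) (hij : i ≠ j) (lam : ℝ)
    (v : Fin (n + 1) → ℝ)
    (hvdef : v = fun k =>
      if k = i then -lam * piv i + piv j
      else if k = j then lam * piv i - piv j
      else 0)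
    (hinv : IsUnit (1 - Zmat P i).det)
    (hd : 1 + ones n ⬝ᵥ ((1 - Zmat P i)⁻¹ *ᵥ alphaVec P i) ≠ 0)
    (x : Fin (n + 1) → ℝ)
    (hsol : x ᵥ* (1 - P) = v) (hx : ∑ k, x k = 0) :
    x i = -((lam * piv i - piv j) *
        (ones n ⬝ᵥ ((1 - Zmat P i)⁻¹ *ᵥ dropIdx i (fun k => if k = j then 1 else 0)))) /
      (1 + ones n ⬝ᵥ ((1 - Zmat P i)⁻¹ *ᵥ alphaVec P i)) := by
  set M := 1 - Zmat P i
  set g := dropIdx i (fun k => if k = j then 1 else 0) with hg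
  have hv : dropIdx i v = (lam * piv i - piv j) • g := by
    ext s
    simp [hvdef, hg, dropIdx, Fin.succAbove_ne]
  have hsys : M *ᵥ dropIdx i x = x i • alphaVec P i + (lam * piv i - piv j) • g := by
    rw [← hv, ← hsol, dropIdx_vecMul_one_sub, add_sub_cancel]
  have hy : dropIdx i x = M⁻¹ *ᵥ (x i • alphaVec P i + (lam * piv i - piv j) • g) := by
    rw [← hsys, Matrix.mulVec_mulVec, Matrix.nonsing_inv_mul _ hinv, Matrix.one_mulVec]
  have hsum : x i + ones n ⬝ᵥ dropIdx i x = 0 := by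
    rw [← hx, Fin.sum_univ_succAbove _ i]
    simp [ones, dropIdx, dotProduct]
  rw [hy, Matrix.mulVec_add, Matrix.mulVec_smul, Matrix.mulVec_smul, dotProduct_add,
    dotProduct_smul, dotProduct_smul, smul_eq_mul, smul_eq_mul] at hsum
  rw [eq_div_iff hd]
  linear_combination hsum
end

section
/- (Theorem 1, Eq. (3)). Let P be an n×n real row-stochastic matrix and let π ∈ ℝⁿ satisfy πP = π, Σ_k π_k = 1, π_k ≥ 0. Fix distinct indices i ≠ j and a real constant λ_{ji}, and let v ∈ ℝⁿ be the row vector whose i-th entry is −λ_{ji}π_i + π_j, whose j-th entry is λ_{ji}π_i − π_j, and whose other entries are 0. Assume Iₙ₋₁ − Z_i is invertible and d := 1 + 𝟏'(Iₙ₋₁ − Z_i)⁻¹ α_i ≠ 0. If x ∈ ℝⁿ satisfies x(Iₙ − P) = v and Σ_k x_k = 0, then the vector x₋ᵢ of coordinates of x other than the i-th satisfies x₋ᵢ = (λ_{ji}π_i − π_j) · (Iₙ₋₁ − Z_i)⁻¹ [ γ_{ji} − (𝟏'(Iₙ₋₁ − Z_i)⁻¹ γ_{ji} / d) · α_i ].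 -/
open Matrix BigOperators

/-- Theorem 1, Eq. (3): in the trade war of country `i` against `j` with reaction
coefficient `λ_{ji}`, the derivative `x = dπ/dP_{ji}` satisfies
`x₋ᵢ = (λ_{ji} π_i − π_j) (Iₙ₋₁ − Z_i)⁻¹ [γ_{ji} − (𝟏ᵀ (Iₙ₋₁ − Z_i)⁻¹ γ_{ji} / d) α_i]`. -/
theorem trade_war_derivative_others (n : ℕ) (P : Matrix (Fin (n + 1)) (Fin (n + 1)) ℝ)
    (hpos : ∀ s t, 0 ≤ P s t) (hrow : ∀ s, ∑ t, P s t = 1)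
    (piv : Fin (n + 1) → ℝ)
    (hpi : piv ᵥ* P = piv) (hpisum : ∑ k, piv k = 1) (hpipos : ∀ k, 0 ≤ piv k)
    (i j : Fin (n + 1)) (hij : i ≠ j) (lam : ℝ)
    (v : Fin (n + 1) → ℝ)
    (hvdef : v = fun k =>
      if k = i then -lam * piv i + piv j
      else if k = j then lam * piv i - piv j
      else 0)
    (hinv : IsUnit (1 - Zmat P i).det)
    (hd : 1 + ones n ⬝ᵥ ((1 - Zmat P i)⁻¹ *ᵥ alphaVec P i) ≠ 0)
    (x : Fin (n + 1) → ℝ)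
    (hsol : x ᵥ* (1 - P) = v) (hx : ∑ k, x k = 0) :
    dropIdx i x =
      (lam * piv i - piv j) •
        ((1 - Zmat P i)⁻¹ *ᵥ
          (dropIdx i (fun k => if k = j then 1 else 0) -
            ((ones n ⬝ᵥ ((1 - Zmat P i)⁻¹ *ᵥ dropIdx i (fun k => if k = j then 1 else 0))) /
              (1 + ones n ⬝ᵥ ((1 - Zmat P i)⁻¹ *ᵥ alphaVec P i))) • alphaVec P i)) := by
  set γ := dropIdx i (fun k => if k = j then (1 : ℝ) else 0) with hγ
  set c := lam * piv i - piv j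
  have hv : dropIdx i v = c • γ := by
    funext s
    simp [hvdef, hγ, dropIdx, Fin.succAbove_ne, c]
  have hsys : (1 - Zmat P i) *ᵥ dropIdx i x = x i • alphaVec P i + c • γ := by
    rw [← hv, ← hsol, dropIdx_vecMul_one_sub]
    abel
  have hy : dropIdx i x = x i • ((1 - Zmat P i)⁻¹ *ᵥ alphaVec P i) +
      c • ((1 - Zmat P i)⁻¹ *ᵥ γ) := by
    rw [← mulVec_smul, ← mulVec_smul, ← mulVec_add, ← hsys, mulVec_mulVec,
      nonsing_inv_mul _ hinv, one_mulVec]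
  have hsum : ones n ⬝ᵥ dropIdx i x = -x i := by
    rw [Fin.sum_univ_succAbove _ i] at hx
    simp only [dotProduct, ones, dropIdx, one_mul]
    linarith
  have hxi : x i = -c * ((ones n ⬝ᵥ ((1 - Zmat P i)⁻¹ *ᵥ γ)) /
      (1 + ones n ⬝ᵥ ((1 - Zmat P i)⁻¹ *ᵥ alphaVec P i))) := by
    rw [hy, dotProduct_add, dotProduct_smul, dotProduct_smul, smul_eq_mul, smul_eq_mul] at hsum
    rw [← mul_div_assoc, eq_div_iff hd]
    linarith
  rw [hy, hxi, mulVec_sub, mulVec_smul]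
  module
end

section
/- (Theorem 2, Eq. (5)). Let P be an n×n real row-stochastic matrix with P_{ii} ≠ 1 and P_{si} ≠ 1 for all s ≠ i, let π ∈ ℝⁿ satisfy πP = π, Σ_k π_k = 1, π_k ≥ 0, and let λ_{ij} (j ≠ i) be real constants. Define M by M_{ii} = 1; M_{ij} = −P_{ij}/(1−P_{ii}) for j ≠ i; M_{si} = −λ_{is}P_{is}/(1−P_{ii}) for s ≠ i; M_{st} = λ_{is}P_{is}P_{st}/((1−P_{ii})(1−P_{si})) for s,t ≠ i, and let M_i be M with its i-th column removed. Assume Iₙ₋₁ − Z_i is invertible and d := 1 + 𝟏'(Iₙ₋₁ − Z_i)⁻¹ α_i ≠ 0. If x ∈ ℝⁿ satisfies x(Iₙ − P) = πM and Σ_k x_k = 0, then the vector x₋ᵢ of coordinates of x other than the i-th satisfies x₋ᵢ = (Iₙ₋₁ − Z_i)⁻¹ [ (πM_i)' − (𝟏'(Iₙ₋₁ − Z_i)⁻¹ (πM_i)' / d) · α_i ]. -/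
open Matrix BigOperators

/-- The globalization perturbation matrix `M` (so `ΔP = ΔP_{ii} · M`): `M_{ii} = 1`;
`M_{it} = −P_{it}/(1−P_{ii})` for `t ≠ i`; `M_{si} = −λ_{is} P_{is}/(1−P_{ii})` for `s ≠ i`;
`M_{st} = λ_{is} P_{is} P_{st}/((1−P_{ii})(1−P_{si}))` for `s, t ≠ i`. -/
noncomputable def Mmat {n : ℕ} (P : Matrix (Fin (n + 1)) (Fin (n + 1)) ℝ) (i : Fin (n + 1))
    (lam : Fin (n + 1) → ℝ) : Matrix (Fin (n + 1)) (Fin (n + 1)) ℝ :=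
  Matrix.of fun s t =>
    if s = i then
      if t = i then 1 else -P i t / (1 - P i i)
    else
      if t = i then -(lam s * P i s) / (1 - P i i)
      else lam s * P i s * P s t / ((1 - P i i) * (1 - P s i))

/-- The coordinates of a vector are its `i`-th coordinate and those of `dropIdx i`. -/
theorem sum_eq_add_ones_dotProduct_dropIdx {n : ℕ} (i : Fin (n + 1)) (x : Fin (n + 1) → ℝ) :
    ∑ k, x k = x i + ones n ⬝ᵥ dropIdx i x := by
  simp [Fin.sum_univ_succAbove _ i, ones, dropIdx, dotProduct]

/-- Theorem 2, Eq. (5): under the globalization perturbation, the derivative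
`x = dπ/dP_{ii}` satisfies
`x₋ᵢ = (Iₙ₋₁ − Z_i)⁻¹ [ (π M_i)ᵀ − (𝟏ᵀ (Iₙ₋₁ − Z_i)⁻¹ (π M_i)ᵀ / d) α_i ]`. -/
theorem globalization_derivative_others (n : ℕ) (P : Matrix (Fin (n + 1)) (Fin (n + 1)) ℝ)
    (hpos : ∀ s t, 0 ≤ P s t) (hrow : ∀ s, ∑ t, P s t = 1)
    (i : Fin (n + 1)) (hii : P i i ≠ 1) (hsi : ∀ s, s ≠ i → P s i ≠ 1)
    (piv : Fin (n + 1) → ℝ)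
    (hpi : piv ᵥ* P = piv) (hpisum : ∑ k, piv k = 1) (hpipos : ∀ k, 0 ≤ piv k)
    (lam : Fin (n + 1) → ℝ)
    (hinv : IsUnit (1 - Zmat P i).det)
    (hd : 1 + ones n ⬝ᵥ ((1 - Zmat P i)⁻¹ *ᵥ alphaVec P i) ≠ 0)
    (x : Fin (n + 1) → ℝ)
    (hsol : x ᵥ* (1 - P) = piv ᵥ* Mmat P i lam) (hx : ∑ k, x k = 0) :
    dropIdx i x =
      (1 - Zmat P i)⁻¹ *ᵥ
        (dropIdx i (piv ᵥ* Mmat P i lam) -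
          ((ones n ⬝ᵥ ((1 - Zmat P i)⁻¹ *ᵥ dropIdx i (piv ᵥ* Mmat P i lam))) /
            (1 + ones n ⬝ᵥ ((1 - Zmat P i)⁻¹ *ᵥ alphaVec P i))) • alphaVec P i) := by
  rw [sum_eq_add_ones_dotProduct_dropIdx i] at hx
  rw [← hsol]
  set b := dropIdx i (x ᵥ* (1 - P)) with hb
  have hy : dropIdx i x =
      (1 - Zmat P i)⁻¹ *ᵥ b + x i • ((1 - Zmat P i)⁻¹ *ᵥ alphaVec P i) := by
    rw [← Matrix.mulVec_smul, ← Matrix.mulVec_add, hb, dropIdx_vecMul_one_sub, sub_add_cancel,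
      Matrix.mulVec_mulVec, Matrix.nonsing_inv_mul _ hinv, Matrix.one_mulVec]
  have hxi : x i = -((ones n ⬝ᵥ ((1 - Zmat P i)⁻¹ *ᵥ b)) /
      (1 + ones n ⬝ᵥ ((1 - Zmat P i)⁻¹ *ᵥ alphaVec P i))) := by
    rw [hy, dotProduct_add, dotProduct_smul, smul_eq_mul] at hx
    rw [← neg_div, eq_div_iff hd]
    linarith
  rw [Matrix.mulVec_sub, Matrix.mulVec_smul, sub_eq_add_neg, ← neg_smul, ← hxi]
  exact hy
end
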